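/- Let α > 1 and define S(x) = ∫₁^x (1 + cos((log u)^α)) du for x ≥ 1. Then there exists a function H holomorphic on the half-plane {s ∈ ℂ : Re s > 0} such that H(s) = ∫₁^∞ S(x) x^{−s−1} dx − 1/(s−1) for all s with Re s > 1. That is, the Mellin transform of S, after subtraction of the pole term 1/(s−1), extends analytically to Re s > 0. -/

import Mathlib

open MeasureTheory Set

open Filter Topology

lemma integral_Ioi_one_eq_integral_exp (f : ℝ → ℂ) :
    ∫ x in Ioi (1 : ℝ), f x = ∫ t in Ioi (0 : ℝ), (Real.exp t : ℂ) * f (Real.exp t) := by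
  have himg : Real.exp '' Ioi 0 = Ioi 1 := by
    ext y
    constructor
    · rintro ⟨t, ht, rfl⟩
      exact Real.one_lt_exp_iff.2 ht
    · intro hy
      exact ⟨Real.log y, Real.log_pos hy, Real.exp_log (one_pos.trans hy)⟩
  rw [← himg, integral_image_eq_integral_abs_deriv_smul measurableSet_Ioi
    (fun x _ => (Real.hasDerivAt_exp x).hasDerivWithinAt) Real.exp_injective.injOn]
  simp [abs_of_pos (Real.exp_pos _)]

lemma integral_Ioi_one_mul_cpow (f : ℝ → ℂ) (s : ℂ) :
    ∫ x in Ioi (1 : ℝ), f x * (x : ℂ) ^ (s - 1) =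
      ∫ t in Ioi (0 : ℝ), f (Real.exp t) * Complex.exp (s * t) := by
  rw [integral_Ioi_one_eq_integral_exp]
  congr 1 with t
  have : ((Real.exp t : ℝ) : ℂ) ^ (s - 1) = Complex.exp (s * t - t) := by
    rw [Complex.cpow_def_of_ne_zero (by simp [Complex.exp_ne_zero]), ← Complex.ofReal_log
      (Real.exp_pos t).le, Real.log_exp]
    ring_nf
  rw [this, Complex.exp_sub, Complex.ofReal_exp]
  field_simp [Complex.exp_ne_zero]

section

variable {f : ℝ → ℂ} {a : ℝ} {s : ℂ}

lemma locallyIntegrableOn_indicator_Ioi_one (hf : ContinuousOn f (Ioi 0)) :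
    LocallyIntegrableOn ((Ioi (1 : ℝ)).indicator f) (Ioi 0) := by
  intro x hx
  obtain ⟨u, hu, hi⟩ := hf.locallyIntegrableOn (μ := volume) measurableSet_Ioi x hx
  exact ⟨u, hu, hi.indicator measurableSet_Ioi⟩

lemma indicator_Ioi_one_isBigO_atTop (hO : f =O[atTop] fun x : ℝ => x ^ (-a)) :
    (Ioi (1 : ℝ)).indicator f =O[atTop] fun x : ℝ => x ^ (-a) := by
  refine hO.congr' ?_ EventuallyEq.rfl
  filter_upwards [eventually_gt_atTop 1] with x hx
  rw [indicator_of_mem (mem_Ioi.2 hx)]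

lemma indicator_Ioi_one_isBigO_zero (b : ℝ) :
    (Ioi (1 : ℝ)).indicator f =O[𝓝[>] 0] fun x : ℝ => x ^ (-b) := by
  refine (Asymptotics.isBigO_zero _ _).congr' ?_ EventuallyEq.rfl
  filter_upwards [nhdsWithin_le_nhds (Iio_mem_nhds (zero_lt_one' ℝ))] with x hx
  rw [indicator_of_notMem (by simpa using hx.le)]

lemma mellin_indicator_Ioi_one (f : ℝ → ℂ) (s : ℂ) :
    mellin ((Ioi (1 : ℝ)).indicator f) s = ∫ x in Ioi (1 : ℝ), f x * (x : ℂ) ^ (s - 1) := by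
  simp_rw [mellin, smul_eq_mul]
  have : (fun x : ℝ => (x : ℂ) ^ (s - 1) * (Ioi (1 : ℝ)).indicator f x) =
      (Ioi (1 : ℝ)).indicator fun x => f x * (x : ℂ) ^ (s - 1) := by
    ext x
    by_cases hx : x ∈ Ioi (1 : ℝ) <;> simp [hx, mul_comm]
  rw [this, setIntegral_indicator measurableSet_Ioi]
  congr 2
  exact inter_eq_right.2 (Ioi_subset_Ioi zero_le_one)

lemma differentiableAt_integral_Ioi_one_mul_cpow (hf : ContinuousOn f (Ioi 0))
    (hO : f =O[atTop] fun x : ℝ => x ^ (-a)) (hs : s.re < a) :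
    DifferentiableAt ℂ (fun z : ℂ => ∫ x in Ioi (1 : ℝ), f x * (x : ℂ) ^ (z - 1)) s := by
  have := mellin_differentiableAt_of_isBigO_rpow (locallyIntegrableOn_indicator_Ioi_one hf)
    (indicator_Ioi_one_isBigO_atTop hO) hs (indicator_Ioi_one_isBigO_zero (s.re - 1)) (by linarith)
  rwa [funext (mellin_indicator_Ioi_one f)] at this

lemma integrableOn_Ioi_one_mul_cpow (hf : ContinuousOn f (Ioi 0))
    (hO : f =O[atTop] fun x : ℝ => x ^ (-a)) (hs : s.re < a) :
    IntegrableOn (fun x : ℝ => f x * (x : ℂ) ^ (s - 1)) (Ioi 1) := by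
  have := mellinConvergent_of_isBigO_rpow (locallyIntegrableOn_indicator_Ioi_one hf)
    (indicator_Ioi_one_isBigO_atTop hO) hs (indicator_Ioi_one_isBigO_zero (s.re - 1)) (by linarith)
  refine (this.mono_set (Ioi_subset_Ioi zero_le_one)).congr_fun (fun x hx => ?_) measurableSet_Ioi
  simp only [indicator_of_mem hx, smul_eq_mul, mul_comm]

end

section

variable {α w : ℝ}

/-- The exponential `exp (i z ^ α - w z)` along the ray `z = r e ^ (i φ)`, times `e ^ (i φ)`. -/
noncomputable def rayIntegrand (α w φ r : ℝ) : ℂ :=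
  Complex.exp (Complex.I * φ + Complex.I * (r ^ α : ℝ) * Complex.exp (Complex.I * (α * φ : ℝ))
    - w * r * Complex.exp (Complex.I * φ))

/-- The logarithmic derivative of `rayIntegrand` in the angle. -/
noncomputable def rayLogDeriv (α w φ r : ℝ) : ℂ :=
  Complex.I - α * (r ^ α : ℝ) * Complex.exp (Complex.I * (α * φ : ℝ))
    - Complex.I * w * r * Complex.exp (Complex.I * φ)

lemma norm_rayIntegrand_le {θ φ r : ℝ} (hα : 1 < α) (hw : 0 < w) (hθ : α * θ ≤ Real.pi / 2)
    (hφ₀ : 0 ≤ φ) (hφ : φ ≤ θ) (hr : 0 ≤ r) :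
    ‖rayIntegrand α w φ r‖ ≤ Real.exp (-(w * Real.cos θ) * r) := by
  have hpi := Real.pi_pos
  have hsin : 0 ≤ Real.sin (α * φ) :=
    Real.sin_nonneg_of_nonneg_of_le_pi (by positivity) (by nlinarith)
  have hcos : Real.cos θ ≤ Real.cos φ :=
    Real.cos_le_cos_of_nonneg_of_le_pi hφ₀ (by nlinarith) hφ
  rw [rayIntegrand, Complex.norm_exp]
  apply Real.exp_le_exp.2
  have h1 : 0 ≤ r ^ α * Real.sin (α * φ) := mul_nonneg (Real.rpow_nonneg hr _) hsin
  have h2 : w * r * Real.cos θ ≤ w * r * Real.cos φ := by gcongr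
  have e (x : ℝ) : Complex.exp (Complex.I * x) = Real.cos x + Real.sin x * Complex.I := by
    rw [mul_comm, Complex.exp_mul_I]; simp
  rw [e, e]
  simp only [Complex.sub_re, Complex.add_re, Complex.mul_re, Complex.mul_im, Complex.I_re,
    Complex.I_im, Complex.ofReal_re, Complex.ofReal_im, Complex.add_im]
  linarith

lemma norm_rayLogDeriv_le {φ r : ℝ} (hα : 1 < α) (hw : 0 < w) (hr : 0 ≤ r) :
    ‖rayLogDeriv α w φ r‖ ≤ 1 + α * r ^ α + w * r := by
  have e (x : ℝ) : ‖Complex.exp (Complex.I * x)‖ = 1 := Complex.norm_exp_I_mul_ofReal x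
  refine (norm_sub_le _ _).trans (add_le_add ((norm_sub_le _ _).trans (add_le_add ?_ ?_)) ?_)
  · simp
  · rw [norm_mul, norm_mul, e, Complex.norm_real, Complex.norm_real,
      Real.norm_of_nonneg (by linarith), Real.norm_of_nonneg (Real.rpow_nonneg hr _), mul_one]
  · rw [norm_mul, norm_mul, norm_mul, e, Complex.norm_real, Complex.norm_real, Complex.norm_I,
      Real.norm_of_nonneg hw.le, Real.norm_of_nonneg hr, mul_one, one_mul]

lemma hasDerivAt_rayIntegrand_angle (φ r : ℝ) :
    HasDerivAt (fun φ => rayIntegrand α w φ r)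
      (rayIntegrand α w φ r * rayLogDeriv α w φ r) φ := by
  have h0 : HasDerivAt (fun φ : ℝ => (φ : ℂ)) 1 φ := Complex.ofRealCLM.hasDerivAt
  have h1 := (h0.const_mul Complex.I)
  have h2 : HasDerivAt (fun φ : ℝ => Complex.I * ((α * φ : ℝ) : ℂ)) (Complex.I * α) φ := by
    simpa using (h0.const_mul (α : ℂ)).const_mul Complex.I
  have := ((h1.add (h2.cexp.const_mul (Complex.I * (r ^ α : ℝ)))).sub
    (h1.cexp.const_mul ((w : ℂ) * r))).cexp
  refine this.congr_deriv ?_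
  change rayIntegrand α w φ r * _ = _
  rw [rayLogDeriv]
  linear_combination (rayIntegrand α w φ r * α * (r ^ α : ℝ) *
    Complex.exp (Complex.I * (α * φ : ℝ))) * Complex.I_mul_I

lemma hasDerivAt_mul_rayIntegrand (φ : ℝ) {r : ℝ} (hr : 0 < r) :
    HasDerivAt (fun r : ℝ => Complex.I * r * rayIntegrand α w φ r)
      (rayIntegrand α w φ r * rayLogDeriv α w φ r) r := by
  have h0 : HasDerivAt (fun r : ℝ => (r : ℂ)) 1 r := Complex.ofRealCLM.hasDerivAt
  have h1 : HasDerivAt (fun r : ℝ => ((r ^ α : ℝ) : ℂ)) ((α * r ^ (α - 1) : ℝ) : ℂ) r :=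
    (Real.hasDerivAt_rpow_const (Or.inl hr.ne')).ofReal_comp
  have := (h0.const_mul Complex.I).mul ((((h1.const_mul Complex.I).mul_const
    (Complex.exp (Complex.I * (α * φ : ℝ)))).const_add (Complex.I * φ)).sub
    ((h0.const_mul (w : ℂ)).mul_const (Complex.exp (Complex.I * φ)))).cexp
  refine this.congr_deriv ?_
  change Complex.I * 1 * rayIntegrand α w φ r +
    Complex.I * r * (rayIntegrand α w φ r * _) = _
  have hr' : ((r ^ α : ℝ) : ℂ) = r * (r ^ (α - 1) : ℝ) := by
    rw [← Complex.ofReal_mul, Real.rpow_sub_one hr.ne']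
    field_simp
  rw [rayLogDeriv, hr', Complex.ofReal_mul α (r ^ (α - 1))]
  linear_combination (rayIntegrand α w φ r * α * r * (r ^ (α - 1) : ℝ) *
    Complex.exp (Complex.I * (α * φ : ℝ))) * Complex.I_mul_I

lemma continuous_rayIntegrand (hα : 1 < α) (φ : ℝ) : Continuous (rayIntegrand α w φ) := by
  have : Continuous fun r : ℝ => r ^ α := Real.continuous_rpow_const (by linarith)
  unfold rayIntegrand
  fun_prop

lemma continuous_rayLogDeriv (hα : 1 < α) (φ : ℝ) : Continuous (rayLogDeriv α w φ) := by
  have : Continuous fun r : ℝ => r ^ α := Real.continuous_rpow_const (by linarith)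
  unfold rayLogDeriv
  fun_prop

lemma integrableOn_rayBound (hα : 1 < α) {c : ℝ} (hc : 0 < c) :
    IntegrableOn (fun r : ℝ => (1 + α * r ^ α + w * r) * Real.exp (-c * r)) (Ioi 0) := by
  have h (p : ℝ) (hp : -1 < p) : IntegrableOn (fun r : ℝ => r ^ p * Real.exp (-c * r)) (Ioi 0) := by
    simpa using integrableOn_rpow_mul_exp_neg_mul_rpow (s := p) (p := 1) hp one_pos hc
  have := ((h 0 (by norm_num)).add ((h α (by linarith)).const_mul α)).add
    ((h 1 (by norm_num)).const_mul w)
  refine this.congr_fun (fun r _ => ?_) measurableSet_Ioi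
  simp
  ring

lemma integral_rayIntegrand_mul_rayLogDeriv {θ φ : ℝ} (hα : 1 < α) (hw : 0 < w)
    (hθ : α * θ ≤ Real.pi / 2) (hθ' : 0 < Real.cos θ) (hφ₀ : 0 ≤ φ) (hφ : φ ≤ θ) :
    ∫ r in Ioi (0 : ℝ), rayIntegrand α w φ r * rayLogDeriv α w φ r = 0 := by
  have hc : 0 < w * Real.cos θ := mul_pos hw hθ'
  have := integral_Ioi_of_hasDerivAt_of_tendsto (a := 0) (m := 0)
    (f := fun r : ℝ => Complex.I * r * rayIntegrand α w φ r)
    (f' := fun r => rayIntegrand α w φ r * rayLogDeriv α w φ r) ?_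
    (fun r hr => hasDerivAt_mul_rayIntegrand φ hr) ?_ ?_
  · simpa using this
  · have := continuous_rayIntegrand (w := w) hα φ
    exact Continuous.continuousWithinAt (by fun_prop)
  · refine (integrableOn_rayBound (w := w) hα hc).mono'
      ((continuous_rayIntegrand hα φ).mul (continuous_rayLogDeriv hα φ)).aestronglyMeasurable ?_
    filter_upwards [ae_restrict_mem measurableSet_Ioi] with r hr
    rw [norm_mul, mul_comm]
    exact mul_le_mul (norm_rayLogDeriv_le hα hw (le_of_lt hr))
      (norm_rayIntegrand_le hα hw hθ hφ₀ hφ (le_of_lt hr)) (norm_nonneg _)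
      ((norm_nonneg _).trans (norm_rayLogDeriv_le (φ := 0) hα hw (le_of_lt hr)))
  · refine squeeze_zero_norm' ?_ (tendsto_rpow_mul_exp_neg_mul_atTop_nhds_zero 1 _ hc)
    filter_upwards [eventually_ge_atTop 0] with r hr
    rw [norm_mul, norm_mul, Complex.norm_I, one_mul, Complex.norm_real, Real.norm_of_nonneg hr,
      Real.rpow_one]
    gcongr
    exact norm_rayIntegrand_le hα hw hθ hφ₀ hφ hr

/-- Rotation of the ray of integration. The proof parametrises the angle by `θ sin² ψ`, which
stays in `[0, θ]` for every real `ψ`. -/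
lemma integral_rayIntegrand_eq {θ : ℝ} (hα : 1 < α) (hw : 0 < w) (hθ₀ : 0 ≤ θ)
    (hθ : α * θ ≤ Real.pi / 2) (hθ' : 0 < Real.cos θ) :
    ∫ r in Ioi (0 : ℝ), rayIntegrand α w 0 r = ∫ r in Ioi (0 : ℝ), rayIntegrand α w θ r := by
  have hc : 0 < w * Real.cos θ := mul_pos hw hθ'
  have h₀ (ψ : ℝ) : 0 ≤ θ * Real.sin ψ ^ 2 := by positivity
  have h₁ (ψ : ℝ) : θ * Real.sin ψ ^ 2 ≤ θ := mul_le_of_le_one_right hθ₀ (Real.sin_sq_le_one ψ)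
  have hd (ψ : ℝ) : HasDerivAt (fun ψ => θ * Real.sin ψ ^ 2)
      (θ * (2 * Real.sin ψ * Real.cos ψ)) ψ := by
    simpa using ((Real.hasDerivAt_sin ψ).pow 2).const_mul θ
  have key (ψ : ℝ) : HasDerivAt
      (fun ψ => ∫ r in Ioi (0 : ℝ), rayIntegrand α w (θ * Real.sin ψ ^ 2) r) 0 ψ := by
    have := (hasDerivAt_integral_of_dominated_loc_of_deriv_le (μ := volume.restrict (Ioi (0 : ℝ)))
      (F := fun ψ r => rayIntegrand α w (θ * Real.sin ψ ^ 2) r)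
      (F' := fun ψ r => ((θ * (2 * Real.sin ψ * Real.cos ψ) : ℝ) : ℂ) *
        (rayIntegrand α w (θ * Real.sin ψ ^ 2) r * rayLogDeriv α w (θ * Real.sin ψ ^ 2) r))
      (bound := fun r => (θ * 2) *
        ((1 + α * r ^ α + w * r) * Real.exp (-(w * Real.cos θ) * r)))
      (x₀ := ψ) (s := univ) univ_mem ?_ ?_ ?_ ?_ ?_ ?_).2
    · simpa only [integral_const_mul, mul_zero,
        integral_rayIntegrand_mul_rayLogDeriv hα hw hθ hθ' (h₀ ψ) (h₁ ψ)] using this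
    · exact Eventually.of_forall fun ψ => (continuous_rayIntegrand hα _).aestronglyMeasurable
    · have hb : IntegrableOn (fun r => Real.exp (-(w * Real.cos θ) * r)) (Ioi 0) :=
        integrableOn_exp_mul_Ioi (by linarith) 0
      refine Integrable.mono' hb (continuous_rayIntegrand hα _).aestronglyMeasurable ?_
      filter_upwards [ae_restrict_mem measurableSet_Ioi] with r hr
      exact norm_rayIntegrand_le hα hw hθ (h₀ ψ) (h₁ ψ) (le_of_lt hr)
    · exact (continuous_const.mul
        ((continuous_rayIntegrand hα _).mul (continuous_rayLogDeriv hα _))).aestronglyMeasurable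
    · filter_upwards [ae_restrict_mem measurableSet_Ioi] with r hr ψ _
      rw [norm_mul, norm_mul, mul_comm ‖rayIntegrand _ _ _ _‖]
      have hr' : (0 : ℝ) ≤ r := le_of_lt hr
      have hsc : |2 * Real.sin ψ * Real.cos ψ| ≤ 2 := by
        rw [← Real.sin_two_mul]
        exact (Real.abs_sin_le_one _).trans one_le_two
      have := (norm_nonneg _).trans (norm_rayLogDeriv_le (φ := 0) hα hw hr')
      refine mul_le_mul ?_ (mul_le_mul (norm_rayLogDeriv_le hα hw hr')
        (norm_rayIntegrand_le hα hw hθ (h₀ ψ) (h₁ ψ) hr') (norm_nonneg _) this)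
        (by positivity) (by positivity)
      rw [Complex.norm_real, Real.norm_eq_abs, abs_mul, abs_of_nonneg hθ₀]
      gcongr
    · exact (integrableOn_rayBound (w := w) hα hc).const_mul _
    · filter_upwards with r ψ _
      simpa [Function.comp_def] using
        (hasDerivAt_rayIntegrand_angle (α := α) (w := w) (θ * Real.sin ψ ^ 2) r).scomp ψ (hd ψ)
  have := is_const_of_deriv_eq_zero (fun ψ => (key ψ).differentiableAt) (fun ψ => (key ψ).deriv)
    0 (Real.pi / 2)
  simpa using this

end

section

variable {α : ℝ}

lemma continuousOn_log_rpow (hα : 1 < α) : ContinuousOn (fun x => Real.log x ^ α) (Ioi 0) :=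
  (Real.continuous_rpow_const (by linarith)).comp_continuousOn
    (Real.continuousOn_log.mono fun _ hx => ne_of_gt hx)

lemma exp_neg_log_rpow_isBigO (hα : 1 < α) (a : ℝ) :
    (fun x : ℝ => Complex.exp (-(Real.log x ^ α : ℝ))) =O[atTop] fun x : ℝ => x ^ (-a) := by
  refine Asymptotics.IsBigO.of_bound 1 ?_
  have h := (tendsto_rpow_atTop (sub_pos.2 hα)).comp Real.tendsto_log_atTop
  filter_upwards [h.eventually_ge_atTop a, eventually_gt_atTop 1] with x hx hx1
  have hl : 0 < Real.log x := Real.log_pos hx1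
  have hx0 : 0 < x := one_pos.trans hx1
  rw [one_mul, ← Complex.ofReal_neg, Complex.norm_exp, Complex.ofReal_re,
    Real.norm_of_nonneg (Real.rpow_nonneg hx0.le _), Real.rpow_def_of_pos hx0]
  apply Real.exp_le_exp.2
  have : Real.log x ^ α = Real.log x * Real.log x ^ (α - 1) := by
    rw [Real.rpow_sub_one hl.ne']
    field_simp
  rw [this]
  simp only [Function.comp_apply] at hx
  nlinarith

lemma differentiable_integral_exp_neg_rpow (hα : 1 < α) :
    Differentiable ℂ fun z : ℂ =>
      ∫ t in Ioi (0 : ℝ), Complex.exp (-(t ^ α : ℝ)) * Complex.exp (z * t) := by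
  intro z
  have hc : ContinuousOn (fun x : ℝ => Complex.exp (-(Real.log x ^ α : ℝ))) (Ioi 0) :=
    (Complex.continuous_ofReal.comp_continuousOn (continuousOn_log_rpow hα)).neg.cexp
  have := differentiableAt_integral_Ioi_one_mul_cpow (s := z) hc
    (exp_neg_log_rpow_isBigO hα (z.re + 1)) (by linarith)
  simpa only [integral_Ioi_one_mul_cpow, Real.log_exp] using this

/-- The entire function `w ↦ c ∫₀^∞ exp (-t ^ α - w c t) dt`. -/
noncomputable def rotatedLaplace (α : ℝ) (c w : ℂ) : ℂ :=
  c * ∫ t in Ioi (0 : ℝ), Complex.exp (-(t ^ α : ℝ)) * Complex.exp (-(w * c) * t)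

lemma differentiable_rotatedLaplace (hα : 1 < α) (c : ℂ) :
    Differentiable ℂ (rotatedLaplace α c) :=
  ((differentiable_integral_exp_neg_rpow hα).comp
    (f := fun w : ℂ => -(w * c)) (by fun_prop)).const_mul c

lemma integral_exp_I_mul_rpow {w : ℝ} (hα : 1 < α) (hw : 0 < w) :
    ∫ t in Ioi (0 : ℝ), Complex.exp (Complex.I * (t ^ α : ℝ) - w * t) =
      rotatedLaplace α (Complex.exp (Complex.I * (Real.pi / (2 * α) : ℝ))) w := by
  have hpi := Real.pi_pos
  have hα0 : 0 < α := by linarith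
  have hθ : α * (Real.pi / (2 * α)) = Real.pi / 2 := by field_simp
  have hlt : Real.pi / (2 * α) < Real.pi / 2 := by
    apply div_lt_div_of_pos_left hpi two_pos (by linarith)
  have h0 : 0 ≤ Real.pi / (2 * α) := by positivity
  have := integral_rayIntegrand_eq hα hw h0 hθ.le
    (Real.cos_pos_of_mem_Ioo ⟨by linarith, hlt⟩)
  have hI : Complex.exp (Complex.I * (Real.pi / 2 : ℝ)) = Complex.I := by
    rw [mul_comm]
    push_cast
    exact Complex.exp_pi_div_two_mul_I
  rw [rotatedLaplace, ← integral_const_mul]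
  refine Eq.trans ?_ (this.trans ?_) <;> congr 1 with t
  · simp [rayIntegrand]
  · rw [rayIntegrand, hθ, hI, ← Complex.exp_add, ← Complex.exp_add]
    congr 1
    linear_combination ((t ^ α : ℝ) : ℂ) * Complex.I_mul_I

lemma integral_exp_neg_I_mul_rpow {w : ℝ} (hα : 1 < α) (hw : 0 < w) :
    ∫ t in Ioi (0 : ℝ), Complex.exp (-Complex.I * (t ^ α : ℝ) - w * t) =
      rotatedLaplace α (Complex.exp (-Complex.I * (Real.pi / (2 * α) : ℝ))) w := by
  have := congrArg (starRingEnd ℂ) (integral_exp_I_mul_rpow hα hw)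
  rw [rotatedLaplace, map_mul, ← integral_conj, ← integral_conj] at this
  simpa only [rotatedLaplace, ← Complex.exp_conj, map_mul, map_sub, map_neg, Complex.conj_I,
    Complex.conj_ofReal] using this

lemma integral_one_add_cos_rpow_mul_exp {w : ℝ} (hα : 1 < α) (hw : 0 < w) :
    ∫ t in Ioi (0 : ℝ), ((1 + Real.cos (t ^ α) : ℝ) : ℂ) * Complex.exp (-(w : ℂ) * t) =
      1 / w + (rotatedLaplace α (Complex.exp (Complex.I * (Real.pi / (2 * α) : ℝ))) w +
        rotatedLaplace α (Complex.exp (-Complex.I * (Real.pi / (2 * α) : ℝ))) w) / 2 := by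
  have hb : IntegrableOn (fun t : ℝ => Real.exp (-w * t)) (Ioi 0) :=
    integrableOn_exp_mul_Ioi (by linarith) 0
  have hcont : Continuous fun t : ℝ => t ^ α := Real.continuous_rpow_const (by linarith)
  have i0 : IntegrableOn (fun t : ℝ => Complex.exp (-(w : ℂ) * t)) (Ioi 0) := by
    refine Integrable.mono' hb (by fun_prop) (Eventually.of_forall fun t => ?_)
    simp [Complex.norm_exp]
  have i1 : IntegrableOn
      (fun t : ℝ => Complex.exp (Complex.I * (t ^ α : ℝ) - w * t)) (Ioi 0) := by
    refine Integrable.mono' hb (by fun_prop) (Eventually.of_forall fun t => ?_)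
    simp [Complex.norm_exp]
  have i2 : IntegrableOn
      (fun t : ℝ => Complex.exp (-Complex.I * (t ^ α : ℝ) - w * t)) (Ioi 0) := by
    refine Integrable.mono' hb (by fun_prop) (Eventually.of_forall fun t => ?_)
    simp [Complex.norm_exp]
  have h0 : ∫ t in Ioi (0 : ℝ), Complex.exp (-(w : ℂ) * t) = 1 / w := by
    rw [integral_exp_mul_complex_Ioi (by simpa using hw)]
    simp
  rw [← integral_exp_I_mul_rpow hα hw, ← integral_exp_neg_I_mul_rpow hα hw, ← h0,
    ← integral_add i1 i2, ← integral_div]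
  refine Eq.trans ?_ (integral_add i0 ((i1.add i2).div_const 2))
  congr 1 with t
  have e1 : Complex.exp (Complex.I * (t ^ α : ℝ) - w * t) =
      Complex.exp ((t ^ α : ℝ) * Complex.I) * Complex.exp (-(w : ℂ) * t) := by
    rw [← Complex.exp_add]; ring_nf
  have e2 : Complex.exp (-Complex.I * (t ^ α : ℝ) - w * t) =
      Complex.exp (-(t ^ α : ℝ) * Complex.I) * Complex.exp (-(w : ℂ) * t) := by
    rw [← Complex.exp_add]; ring_nf
  rw [e1, e2, Complex.ofReal_add, Complex.ofReal_cos, Complex.cos, Complex.ofReal_one]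
  ring

end

section

variable {g : ℝ → ℝ} {C : ℝ}

lemma continuous_primitive_of_bounded (hm : Measurable g) (hC : ∀ x, |g x| ≤ C) :
    Continuous fun x => ∫ u in (1 : ℝ)..x, g u := by
  refine intervalIntegral.continuous_primitive (fun a b => ?_) 1
  exact (intervalIntegrable_const (c := C)).mono_fun hm.aestronglyMeasurable
    (Eventually.of_forall fun x => (hC x).trans (le_abs_self C))

lemma primitive_isBigO (hC : ∀ x, |g x| ≤ C) :
    (fun x : ℝ => ((∫ u in (1 : ℝ)..x, g u : ℝ) : ℂ)) =O[atTop] fun x : ℝ => x ^ (-(-1 : ℝ)) := by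
  refine Asymptotics.IsBigO.of_bound C ?_
  filter_upwards [eventually_ge_atTop 1] with x hx
  have hC0 : 0 ≤ C := (abs_nonneg _).trans (hC 0)
  rw [neg_neg, Real.rpow_one, Complex.norm_real, Real.norm_of_nonneg (by linarith : (0 : ℝ) ≤ x)]
  refine (intervalIntegral.norm_integral_le_of_norm_le_const fun u _ => hC u).trans ?_
  rw [abs_of_nonneg (by linarith)]
  gcongr
  linarith

lemma integral_primitive_mul_cpow (hm : Measurable g) (hc : ContinuousOn g (Ioi 0))
    (hC : ∀ x, |g x| ≤ C) {s : ℂ} (hs : 1 < s.re) :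
    ∫ x in Ioi (1 : ℝ), ((∫ u in (1 : ℝ)..x, g u : ℝ) : ℂ) * (x : ℂ) ^ (-s - 1) =
      (∫ x in Ioi (1 : ℝ), (g x : ℂ) * (x : ℂ) ^ (1 - s - 1)) / s := by
  have hs0 : s ≠ 0 := by
    rintro rfl
    norm_num at hs
  set S : ℝ → ℂ := fun x => ((∫ u in (1 : ℝ)..x, g u : ℝ) : ℂ)
  have hS : Continuous S :=
    Complex.continuous_ofReal.comp (continuous_primitive_of_bounded hm hC)
  have hSO : S =O[atTop] fun x : ℝ => x ^ (-(-1 : ℝ)) := primitive_isBigO hC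
  have iS : IntegrableOn (fun x : ℝ => S x * (x : ℂ) ^ (-s - 1)) (Ioi 1) :=
    integrableOn_Ioi_one_mul_cpow hS.continuousOn hSO (by simpa using hs)
  have ig : IntegrableOn (fun x : ℝ => (g x : ℂ) * (x : ℂ) ^ (1 - s - 1)) (Ioi 1) := by
    refine integrableOn_Ioi_one_mul_cpow (a := 0)
      (Complex.continuous_ofReal.comp_continuousOn hc) ?_ (by simpa using hs)
    refine Asymptotics.IsBigO.of_bound C (Eventually.of_forall fun x => ?_)
    simpa using hC x
  have hder (x : ℝ) (hx : x ∈ Ioi (1 : ℝ)) : HasDerivAt (fun x : ℝ => S x * (x : ℂ) ^ (-s))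
      ((g x : ℂ) * (x : ℂ) ^ (1 - s - 1) - s * (S x * (x : ℂ) ^ (-s - 1))) x := by
    have hx0 : 0 < x := one_pos.trans hx
    have h1 : HasDerivAt S (g x : ℂ) x := by
      refine (intervalIntegral.integral_hasDerivAt_right ?_
        hm.stronglyMeasurable.stronglyMeasurableAtFilter
        (hc.continuousAt (Ioi_mem_nhds hx0))).ofReal_comp
      exact (intervalIntegrable_const (c := C)).mono_fun hm.aestronglyMeasurable
        (Eventually.of_forall fun x => (hC x).trans (le_abs_self C))
    have h2 : HasDerivAt (fun x : ℝ => (x : ℂ) ^ (-s)) (-s * (x : ℂ) ^ (-s - 1)) x := by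
      simpa using ((hasDerivAt_id (x : ℂ)).cpow_const
        (c := -s) (Or.inl (by simpa using hx0))).comp_ofReal
    refine (h1.mul h2).congr_deriv ?_
    rw [show (1 - s - 1 : ℂ) = -s by ring]
    ring
  have hlim : Tendsto (fun x : ℝ => S x * (x : ℂ) ^ (-s)) atTop (𝓝 0) := by
    have h1 : (fun x : ℝ => (x : ℂ) ^ (-s)) =O[atTop] fun x : ℝ => x ^ (-s.re) := by
      refine Asymptotics.IsBigO.of_bound 1 ?_
      filter_upwards [eventually_gt_atTop 0] with x hx
      rw [Complex.norm_cpow_eq_rpow_re_of_pos hx, Complex.neg_re, one_mul]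
      exact le_abs_self _
    refine (hSO.mul h1).trans_tendsto ?_
    refine (tendsto_rpow_neg_atTop (sub_pos.2 hs)).congr' ?_
    filter_upwards [eventually_gt_atTop 0] with x hx
    rw [← Real.rpow_add hx]
    ring_nf
  have key := integral_Ioi_of_hasDerivAt_of_tendsto (a := 1) ?_ hder
    (ig.sub (iS.const_mul s)) hlim
  · rw [integral_sub ig (iS.const_mul s), integral_const_mul] at key
    have hS1 : S 1 = 0 := by simp [S]
    rw [hS1] at key
    rw [eq_div_iff hs0]
    linear_combination -key
  · refine (hS.continuousAt.mul ?_).continuousWithinAt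
    exact ((continuousAt_cpow_const (by simp)).comp Complex.continuous_ofReal.continuousAt)

end

lemma Complex.eqOn_of_eq_ofReal {f g : ℂ → ℂ} {a : ℝ}
    (hf : DifferentiableOn ℂ f {s | a < s.re}) (hg : DifferentiableOn ℂ g {s | a < s.re})
    (h : ∀ x : ℝ, a < x → f x = g x) : EqOn f g {s | a < s.re} := by
  have hopen : IsOpen {s : ℂ | a < s.re} := isOpen_lt continuous_const Complex.continuous_re
  have hconn : IsPreconnected {s : ℂ | a < s.re} := (convex_halfSpace_re_gt a).isPreconnected
  refine (hf.analyticOnNhd hopen).eqOn_of_preconnected_of_frequently_eq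
    (hg.analyticOnNhd hopen) hconn (z₀ := ((a + 1 : ℝ) : ℂ)) (by simp) ?_
  have ht : Tendsto (fun x : ℝ => (x : ℂ)) (𝓝[≠] (a + 1)) (𝓝[≠] ((a + 1 : ℝ) : ℂ)) :=
    Complex.continuous_ofReal.continuousWithinAt.tendsto_nhdsWithin fun x hx =>
      Complex.ofReal_injective.ne hx
  refine ht.frequently (Eventually.frequently ?_)
  filter_upwards [nhdsWithin_le_nhds (Ioi_mem_nhds (lt_add_one a))] with x hx using h x hx

/-- The Mellin transform of `S(x) = ∫₁ˣ (1 + cos((log u)^α)) du`, after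
subtraction of the pole term `1/(s−1)`, extends analytically to the
half-plane `Re s > 0`. -/
theorem stmt_15 (α : ℝ) (hα : 1 < α) :
    ∃ H : ℂ → ℂ, DifferentiableOn ℂ H {s : ℂ | 0 < s.re} ∧
      ∀ s : ℂ, 1 < s.re →
        H s = (∫ x in Ioi (1:ℝ),
            (↑(∫ u in (1:ℝ)..x, (1 + Real.cos (Real.log u ^ α))) : ℂ) *
              (x : ℂ) ^ (-s - 1)) - 1 / (s - 1) := by
  set c₁ := Complex.exp (Complex.I * (Real.pi / (2 * α) : ℝ))
  set c₂ := Complex.exp (-Complex.I * (Real.pi / (2 * α) : ℝ))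
  have hH : DifferentiableOn ℂ
      (fun s => ((rotatedLaplace α c₁ (s - 1) + rotatedLaplace α c₂ (s - 1)) / 2 - 1) / s)
      {s : ℂ | 0 < s.re} := by
    have h (c : ℂ) : Differentiable ℂ fun s => rotatedLaplace α c (s - 1) :=
      (differentiable_rotatedLaplace hα c).comp (f := fun s : ℂ => s - 1) (by fun_prop)
    refine DifferentiableOn.div ?_ differentiableOn_id fun s hs => ?_
    · exact ((((h c₁).add (h c₂)).div_const 2).sub_const 1).differentiableOn
    · rintro rfl
      simp at hs
  have hm : Measurable fun u : ℝ => 1 + Real.cos (Real.log u ^ α) := by fun_prop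
  have hb (u : ℝ) : |1 + Real.cos (Real.log u ^ α)| ≤ 2 := by
    rw [abs_le]
    constructor <;> linarith [Real.neg_one_le_cos (Real.log u ^ α),
      Real.cos_le_one (Real.log u ^ α)]
  refine ⟨_, hH, Complex.eqOn_of_eq_ofReal (hH.mono ?_) ?_ ?_⟩
  · exact fun s (hs : 1 < s.re) => zero_lt_one.trans hs
  · intro s hs
    have hs' : (-s).re < -1 := by simpa using hs
    have h1 := (differentiableAt_integral_Ioi_one_mul_cpow
      (Complex.continuous_ofReal.comp (continuous_primitive_of_bounded hm hb)).continuousOn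
      (primitive_isBigO hb) hs').comp s differentiableAt_id.neg
    refine (h1.sub (DifferentiableAt.div (by fun_prop) (by fun_prop) ?_)).differentiableWithinAt
    intro h
    rw [sub_eq_zero.1 h] at hs
    simp at hs
  · intro x hx
    have hw : 0 < x - 1 := by linarith
    have hc : ContinuousOn (fun u : ℝ => 1 + Real.cos (Real.log u ^ α)) (Ioi 0) :=
      continuousOn_const.add (Real.continuous_cos.comp_continuousOn (continuousOn_log_rpow hα))
    have e : (1 - x : ℂ) = -((x - 1 : ℝ) : ℂ) := by
      push_cast
      ring
    have hx0 : (x : ℂ) ≠ 0 := by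
      exact_mod_cast (zero_lt_one.trans hx).ne'
    have hx1 : (x - 1 : ℂ) ≠ 0 := by
      exact_mod_cast hw.ne'
    rw [integral_primitive_mul_cpow hm hc hb (by simpa using hx), integral_Ioi_one_mul_cpow, e]
    simp_rw [Real.log_exp]
    have hcos := integral_one_add_cos_rpow_mul_exp hα hw
    change _ = 1 / _ + (rotatedLaplace α c₁ _ + rotatedLaplace α c₂ _) / 2 at hcos
    rw [hcos, Complex.ofReal_sub, Complex.ofReal_one]
    field_simp
    ring
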